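/- Let (X,φ) be a Smale space and let π = (Y,ψ,π_s,Z,ζ,π_u) be an s/u-bijective pair for (X,φ). For L, M ≥ 0, let Σ_{L,M}(π) = {(y₀,…,y_L,z₀,…,z_M) ∈ Y^{L+1} × Z^{M+1} : π_s(y_i) = π_u(z_j) for all i, j}, with the homeomorphism σ = ψ × ⋯ × ψ × ζ × ⋯ × ζ. Then Σ_{L,M}(π) is a closed, σ-invariant subset of Y^{L+1} × Z^{M+1}, and Σ_{L,M}(π) is a totally disconnected compact metrizable space. -/

import Mathlib

/-- A Smale space bracket on a compact metric space `X` with homeomorphism `φ`: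
a constant `ε > 0`, a constant `0 < λ < 1`, and a map `[·,·]` (here a total map whose
relevant values are those on `{(x,y) | dist x y ≤ ε}`, on which it is continuous),
satisfying the Smale space axioms B1–B4, C1, C2 (each axiom is imposed whenever
both sides are defined, i.e. whenever the relevant distance conditions hold). -/
structure SmaleBracket (X : Type*) [MetricSpace X] (φ : X ≃ₜ X) where
  eps : ℝ
  eps_pos : 0 < eps
  lam : ℝ
  lam_pos : 0 < lam
  lam_lt_one : lam < 1
  br : X → X → X
  continuousOn : ContinuousOn (fun p : X × X => br p.1 p.2) {p : X × X | dist p.1 p.2 ≤ eps}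
  B1 : ∀ x : X, br x x = x
  B2 : ∀ x y z : X, dist y z ≤ eps → dist x (br y z) ≤ eps → dist x z ≤ eps →
    br x (br y z) = br x z
  B3 : ∀ x y z : X, dist x y ≤ eps → dist (br x y) z ≤ eps → dist x z ≤ eps →
    br (br x y) z = br x z
  B4 : ∀ x y : X, dist x y ≤ eps → dist (φ x) (φ y) ≤ eps →
    φ (br x y) = br (φ x) (φ y)
  C1 : ∀ x y : X, dist x y ≤ eps → br x y = y → dist (φ x) (φ y) ≤ lam * dist x y
  C2 : ∀ x y : X, dist x y ≤ eps → br x y = x →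
    dist (φ.symm x) (φ.symm y) ≤ lam * dist x y

/-- The stable set of `x`: points `y` with `d(φⁿ(x), φⁿ(y)) → 0` as `n → ∞`. -/
def stableSet {X : Type*} [MetricSpace X] (φ : X ≃ₜ X) (x : X) : Set X :=
  {y | Filter.Tendsto (fun n : ℕ => dist ((⇑φ)^[n] x) ((⇑φ)^[n] y))
    Filter.atTop (nhds 0)}

/-- The unstable set of `x`: points `y` with `d(φ⁻ⁿ(x), φ⁻ⁿ(y)) → 0` as `n → ∞`. -/
def unstableSet {X : Type*} [MetricSpace X] (φ : X ≃ₜ X) (x : X) : Set X :=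
  {y | Filter.Tendsto (fun n : ℕ => dist ((⇑φ.symm)^[n] x) ((⇑φ.symm)^[n] y))
    Filter.atTop (nhds 0)}

section FiberProduct

open Set Filter Topology

namespace SmaleBracket

variable {X : Type*} [MetricSpace X] {φ : X ≃ₜ X}

/-- The time-reversed bracket, a Smale bracket for `φ⁻¹`. -/
def symm (B : SmaleBracket X φ) : SmaleBracket X φ.symm where
  eps := B.eps
  eps_pos := B.eps_pos
  lam := B.lam
  lam_pos := B.lam_pos
  lam_lt_one := B.lam_lt_one
  br x y := B.br y x
  continuousOn := B.continuousOn.comp continuous_swap.continuousOn fun p hp => by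
    simpa [dist_comm] using hp
  B1 := B.B1
  B2 x y z h₁ h₂ h₃ := B.B3 z y x (dist_comm y z ▸ h₁) (dist_comm x _ ▸ h₂) (dist_comm x z ▸ h₃)
  B3 x y z h₁ h₂ h₃ := B.B2 z y x (dist_comm x y ▸ h₁) (dist_comm _ z ▸ h₂) (dist_comm x z ▸ h₃)
  B4 x y h₁ h₂ := by
    rw [Homeomorph.symm_apply_eq, B.B4 _ _ (by rwa [dist_comm]) (by simpa [dist_comm] using h₁)]
    simp
  C1 x y h₁ h₂ := by
    rw [dist_comm, dist_comm x]
    exact B.C2 y x (by rwa [dist_comm]) h₂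
  C2 x y h₁ h₂ := by
    rw [dist_comm, dist_comm x]
    exact B.C1 y x (by rwa [dist_comm]) h₂

lemma dist_iterate_le (B : SmaleBracket X φ) {x y : X} (h : dist x y ≤ B.eps)
    (hb : B.br x y = y) (n : ℕ) :
    dist (φ^[n] x) (φ^[n] y) ≤ B.lam ^ n * dist x y := by
  induction n generalizing x y with
  | zero => simp
  | succ n ih =>
    have h1 := B.C1 x y h hb
    have h2 : dist (φ x) (φ y) ≤ B.eps :=
      h1.trans ((mul_le_of_le_one_left dist_nonneg B.lam_lt_one.le).trans h)
    have h3 : B.br (φ x) (φ y) = φ y := by rw [← B.B4 x y h h2, hb]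
    calc dist (φ^[n + 1] x) (φ^[n + 1] y) ≤ B.lam ^ n * dist (φ x) (φ y) := ih h2 h3
      _ ≤ B.lam ^ n * (B.lam * dist x y) := by
        have := B.lam_pos
        gcongr
      _ = B.lam ^ (n + 1) * dist x y := by ring

lemma dist_iterate_le_dist (B : SmaleBracket X φ) {x y : X} (h : dist x y ≤ B.eps)
    (hb : B.br x y = y) (n : ℕ) : dist (φ^[n] x) (φ^[n] y) ≤ dist x y :=
  (B.dist_iterate_le h hb n).trans
    (mul_le_of_le_one_left dist_nonneg (pow_le_one₀ B.lam_pos.le B.lam_lt_one.le))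

lemma tendsto_pow_mul (B : SmaleBracket X φ) (c : ℝ) :
    Tendsto (fun n : ℕ => B.lam ^ n * c) atTop (𝓝 0) := by
  simpa using (tendsto_pow_atTop_nhds_zero_of_lt_one B.lam_pos.le B.lam_lt_one).mul_const c

lemma mem_stableSet (B : SmaleBracket X φ) {x y : X} (h : dist x y ≤ B.eps)
    (hb : B.br x y = y) : y ∈ stableSet φ x :=
  squeeze_zero (fun _ => dist_nonneg) (B.dist_iterate_le h hb) (B.tendsto_pow_mul _)

variable [CompactSpace X]

lemma exists_br_dist_le (B : SmaleBracket X φ) {η : ℝ} (hη : 0 < η) :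
    ∃ δ > 0, δ ≤ B.eps ∧ ∀ x y, dist x y ≤ δ →
      dist x (B.br x y) ≤ η ∧ dist (B.br x y) y ≤ η := by
  have hK : IsCompact {p : X × X | dist p.1 p.2 ≤ B.eps} :=
    (isClosed_le (by fun_prop) continuous_const).isCompact
  have hu := hK.uniformContinuousOn_of_continuous B.continuousOn
  obtain ⟨δ, hδ, H⟩ := Metric.uniformContinuousOn_iff.1 hu (η / 2) (half_pos hη)
  refine ⟨min (min (δ / 2) (η / 2)) B.eps, by have := B.eps_pos; positivity,
    min_le_right _ _, fun x y hxy => ?_⟩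
  have h1 : dist x y ≤ δ / 2 := hxy.trans ((min_le_left _ _).trans (min_le_left _ _))
  have h2 : dist x y ≤ η / 2 := hxy.trans ((min_le_left _ _).trans (min_le_right _ _))
  have h3 : dist x y ≤ B.eps := hxy.trans (min_le_right _ _)
  have h4 := H (x, y) h3 (x, x) (by simpa using B.eps_pos.le)
    (by simp only [Prod.dist_eq, dist_self, dist_comm y x]; exact max_lt hδ (by linarith))
  simp only [B.B1] at h4
  have h5 := dist_triangle (B.br x y) x y
  rw [dist_comm x (B.br x y)]
  constructor <;> linarith

/-- Points at distance at most `δ` have a bracket that lies in both local leaves. -/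
lemma exists_br_spec (B : SmaleBracket X φ) {η : ℝ} (hη : 0 < η) :
    ∃ δ > 0, δ ≤ B.eps ∧ ∀ x y, dist x y ≤ δ →
      (dist x (B.br x y) ≤ B.eps ∧ dist x (B.br x y) ≤ η ∧ B.br x (B.br x y) = B.br x y) ∧
      (dist (B.br x y) y ≤ B.eps ∧ dist (B.br x y) y ≤ η ∧ B.br (B.br x y) y = B.br x y) := by
  obtain ⟨δ, hδ, hδe, H⟩ := B.exists_br_dist_le (lt_min hη B.eps_pos)
  refine ⟨δ, hδ, hδe, fun x y hxy => ?_⟩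
  obtain ⟨h1, h2⟩ := H x y hxy
  have h3 := h1.trans (min_le_right _ _)
  have h4 := h2.trans (min_le_right _ _)
  exact ⟨⟨h3, h1.trans (min_le_left _ _), B.B2 _ _ _ (hxy.trans hδe) h3 (hxy.trans hδe)⟩,
    ⟨h4, h2.trans (min_le_left _ _), B.B3 _ _ _ (hxy.trans hδe) h4 (hxy.trans hδe)⟩⟩

lemma exists_br_eq_left (B : SmaleBracket X φ) :
    ∃ δ > 0, ∀ x y, (∀ n : ℕ, dist (φ.symm^[n] x) (φ.symm^[n] y) ≤ δ) → B.br x y = x := by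
  obtain ⟨δ, hδ, hδe, H⟩ := B.exists_br_spec B.eps_pos
  have key : ∀ n : ℕ, ∀ x y, (∀ k : ℕ, dist (φ.symm^[k] x) (φ.symm^[k] y) ≤ δ) →
      dist x (B.br x y) ≤ B.lam ^ n * B.eps := by
    intro n
    induction n with
    | zero => intro x y h; simpa using (H x y (h 0)).1.1
    | succ n ih =>
      intro x y h
      have h1 := ih (φ.symm x) (φ.symm y) fun k => h (k + 1)
      have h2 : dist (φ.symm x) (φ.symm y) ≤ δ := h 1
      have h3 := B.B4 _ _ (h2.trans hδe) (by simpa using (h 0).trans hδe)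
      obtain ⟨h4, -, h5⟩ := (H _ _ h2).1
      have h6 := B.C1 _ _ h4 h5
      rw [h3] at h6
      simp only [Homeomorph.apply_symm_apply] at h6
      calc dist x (B.br x y) ≤ _ := h6
        _ ≤ B.lam * (B.lam ^ n * B.eps) := by
          have := B.lam_pos
          gcongr
        _ = _ := by ring
  refine ⟨δ, hδ, fun x y h => ?_⟩
  have h0 : dist x (B.br x y) ≤ 0 :=
    ge_of_tendsto' (B.tendsto_pow_mul B.eps) fun n => key n x y h
  exact (dist_le_zero.1 h0).symm

/-- Smale spaces are expansive. -/
lemma expansive (B : SmaleBracket X φ) :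
    ∃ δ > 0, ∀ x y, (∀ n : ℕ, dist (φ^[n] x) (φ^[n] y) ≤ δ) →
      (∀ n : ℕ, dist (φ.symm^[n] x) (φ.symm^[n] y) ≤ δ) → x = y := by
  obtain ⟨δ, hδ, H⟩ := B.exists_br_eq_left
  obtain ⟨δ', hδ', H'⟩ := B.symm.exists_br_eq_left
  refine ⟨min δ δ', lt_min hδ hδ', fun x y hf hb => ?_⟩
  have h1 : B.br x y = x := H x y fun n => (hb n).trans (min_le_left _ _)
  have h2 : B.br x y = y := H' y x fun n => by
    rw [dist_comm]
    exact (hf n).trans (min_le_right _ _)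
  exact h1.symm.trans h2

/-- A small connected set lies in one local unstable leaf when the stable sets are totally
disconnected. -/
lemma exists_dist_symm_iterate_le (B : SmaleBracket X φ)
    (hs : ∀ x, IsTotallyDisconnected (stableSet φ x)) :
    ∃ δ > 0, ∀ C : Set X, IsPreconnected C → (∀ x ∈ C, ∀ y ∈ C, dist x y ≤ δ) →
      ∀ x ∈ C, ∀ y ∈ C, ∀ n : ℕ, dist (φ.symm^[n] x) (φ.symm^[n] y) ≤ dist x y := by
  obtain ⟨δ, hδ, hδe, H⟩ := B.exists_br_spec B.eps_pos
  refine ⟨δ, hδ, fun C hC hd x hx y hy n => ?_⟩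
  have hcont : ContinuousOn (B.br x) C :=
    B.continuousOn.comp (f := fun y => (x, y)) (by fun_prop) fun y hy => (hd x hx y hy).trans hδe
  have hsub : B.br x '' C ⊆ stableSet φ x := by
    rintro _ ⟨y, hy, rfl⟩
    obtain ⟨h1, -, h2⟩ := (H x y (hd x hx y hy)).1
    exact B.mem_stableSet h1 h2
  have hxy : B.br x y = x := by
    simpa [B.B1] using
      hs x _ hsub (hC.image _ hcont) (mem_image_of_mem _ hy) (mem_image_of_mem _ hx)
  have hdist := (hd x hx y hy).trans hδe
  have hyx : B.br y x = y := by
    have := B.B2 y x y hdist (by rwa [hxy, dist_comm]) (by simpa using B.eps_pos.le)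
    rwa [hxy, B.B1] at this
  exact B.symm.dist_iterate_le_dist hdist hyx n

end SmaleBracket

section FactorMap

variable {X Y : Type*} {φ : X → X} {ψ : Y → Y} {π : Y → X}

lemma exists_dist_iterate_map_le [MetricSpace X] [MetricSpace Y] [CompactSpace Y]
    (hπ : Continuous π) (hcomm : Function.Semiconj π ψ φ) {η : ℝ} (hη : 0 < η) :
    ∃ δ > 0, ∀ y y' : Y, ∀ n : ℕ, dist (ψ^[n] y) (ψ^[n] y') ≤ δ →
      dist (φ^[n] (π y)) (φ^[n] (π y')) ≤ η := by
  obtain ⟨δ, hδ, H⟩ := Metric.uniformContinuous_iff.1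
    (CompactSpace.uniformContinuous_of_continuous hπ) η hη
  refine ⟨δ / 2, half_pos hδ, fun y y' n h => ?_⟩
  rw [← (hcomm.iterate_right n).eq, ← (hcomm.iterate_right n).eq]
  exact (H (h.trans_lt (half_lt_self hδ))).le

end FactorMap

lemma Homeomorph.semiconj_symm {X Y : Type*} [TopologicalSpace X] [TopologicalSpace Y]
    {φ : X ≃ₜ X} {ψ : Y ≃ₜ Y} {π : Y → X} (h : Function.Semiconj π ψ φ) :
    Function.Semiconj π ψ.symm φ.symm := fun y => by
  rw [Homeomorph.eq_symm_apply, ← h.eq, Homeomorph.apply_symm_apply]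

section Fibers

variable {X Y : Type*} [MetricSpace X] [CompactSpace X] [MetricSpace Y] [CompactSpace Y]
  {φ : X ≃ₜ X} {ψ : Y ≃ₜ Y} {π : Y → X}

/-- Nearby points in a fiber of an s-bijective map are unstably equivalent. -/
lemma exists_br_eq_left_of_map_eq (BX : SmaleBracket X φ) (BY : SmaleBracket Y ψ)
    (hπ : Continuous π) (hcomm : Function.Semiconj π ψ φ)
    (hinj : ∀ y, InjOn π (stableSet ψ y)) :
    ∃ δ > 0, δ ≤ BY.eps ∧ ∀ y y', π y = π y' → dist y y' ≤ δ → BY.br y y' = y := by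
  obtain ⟨η, hη, hexp⟩ := BX.expansive
  obtain ⟨δ₁, hδ₁, H₁⟩ := exists_dist_iterate_map_le hπ hcomm hη
  obtain ⟨δ₂, hδ₂, H₂⟩ :=
    exists_dist_iterate_map_le hπ (Homeomorph.semiconj_symm hcomm) hη
  obtain ⟨δ, hδ, hδe, H⟩ := BY.exists_br_spec (lt_min hδ₁ hδ₂)
  refine ⟨δ, hδ, hδe, fun y y' hyy' hd => ?_⟩
  obtain ⟨⟨ha, ha', hab⟩, hc, hc', hcb⟩ := H y y' hd
  have hmap : π y = π (BY.br y y') := by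
    refine hexp _ _ (fun n => H₁ _ _ n ?_) (fun n => ?_)
    · exact (BY.dist_iterate_le_dist ha hab n).trans (ha'.trans (min_le_left _ _))
    · rw [hyy']
      refine H₂ _ _ n ((BY.symm.dist_iterate_le_dist ?_ hcb n).trans ?_)
      · rwa [dist_comm]
      · rw [dist_comm]
        exact hc'.trans (min_le_right _ _)
  exact (hinj y (BY.mem_stableSet (by simpa using BY.eps_pos.le) (BY.B1 y))
    (BY.mem_stableSet ha hab) hmap).symm

/-- Distinct points in a fiber of an s-bijective map are eventually uniformly separated. -/
lemma exists_eventually_lt_dist (BX : SmaleBracket X φ) (BY : SmaleBracket Y ψ)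
    (hπ : Continuous π) (hcomm : Function.Semiconj π ψ φ)
    (hinj : ∀ y, InjOn π (stableSet ψ y)) :
    ∃ δ > 0, ∀ y y', π y = π y' → y ≠ y' →
      ∀ᶠ n : ℕ in atTop, δ < dist (ψ^[n] y) (ψ^[n] y') := by
  obtain ⟨δ, hδ, hδe, H⟩ := exists_br_eq_left_of_map_eq BX BY hπ hcomm hinj
  refine ⟨δ, hδ, fun y y' hyy' hne => ?_⟩
  have hpos : 0 < dist y y' := dist_pos.2 hne
  filter_upwards [(BY.tendsto_pow_mul BY.eps).eventually_lt_const hpos] with n hn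
  by_contra! hle
  have hmap : π (ψ^[n] y) = π (ψ^[n] y') := by
    rw [(hcomm.iterate_right n).eq, (hcomm.iterate_right n).eq, hyy']
  have hb := H _ _ hmap hle
  have h := BY.symm.dist_iterate_le (x := ψ^[n] y') (y := ψ^[n] y)
    (by rw [dist_comm]; exact hle.trans hδe) hb n
  have hleft : Function.LeftInverse (ψ.symm^[n]) (ψ^[n]) :=
    Function.LeftInverse.iterate ψ.symm_apply_apply n
  rw [hleft, hleft, dist_comm, dist_comm (ψ^[n] y')] at h
  have h2 : BY.lam ^ n * dist (ψ^[n] y) (ψ^[n] y') ≤ BY.lam ^ n * BY.eps := by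
    have := BY.lam_pos
    gcongr
    exact hle.trans hδe
  exact absurd (h.trans h2) (not_le.2 hn)

lemma finite_fiber (BX : SmaleBracket X φ) (BY : SmaleBracket Y ψ)
    (hπ : Continuous π) (hcomm : Function.Semiconj π ψ φ)
    (hinj : ∀ y, InjOn π (stableSet ψ y)) (x : X) : (π ⁻¹' {x}).Finite := by
  obtain ⟨δ, hδ, H⟩ := exists_eventually_lt_dist BX BY hπ hcomm hinj
  obtain ⟨t, htf, ht⟩ := Metric.totallyBounded_iff.1
    (isCompact_univ (X := Y)).totallyBounded (δ / 2) (half_pos hδ)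
  by_contra hinf
  obtain ⟨s, hsub, hcard⟩ := Set.Infinite.exists_subset_card_eq hinf (htf.toFinset.card + 1)
  have hev : ∀ᶠ n : ℕ in atTop, ∀ y ∈ s, ∀ y' ∈ s, y ≠ y' →
      δ < dist (ψ^[n] y) (ψ^[n] y') := by
    rw [Filter.eventually_all_finset]
    intro y hy
    rw [Filter.eventually_all_finset]
    intro y' hy'
    by_cases hne : y = y'
    · simp [hne]
    · filter_upwards [H y y' ((hsub hy).trans (hsub hy').symm) hne] with n hn _ using hn
  obtain ⟨n, hn⟩ := hev.exists
  have hcov : ∀ y : Y, ∃ c ∈ t, dist y c < δ / 2 := fun y => by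
    simpa using ht (mem_univ y)
  choose c hct hcd using hcov
  obtain ⟨y, hy, y', hy', hne, heq⟩ := Finset.exists_ne_map_eq_of_card_lt_of_maps_to
    (s := s) (t := htf.toFinset) (f := fun y => c (ψ^[n] y)) (by omega)
    (fun y _ => by simpa using hct _)
  have h1 := hcd (ψ^[n] y)
  have h2 := hcd (ψ^[n] y')
  rw [← heq] at h2
  have h3 := dist_triangle_right (ψ^[n] y) (ψ^[n] y') (c (ψ^[n] y))
  linarith [hn y hy y' hy' hne]

end Fibers

lemma IsPreconnected.subsingleton_of_finite {X : Type*} [TopologicalSpace X] [T1Space X]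
    {s : Set X} (hs : IsPreconnected s) (hf : s.Finite) : s.Subsingleton := by
  by_contra h
  exact hs.infinite_of_nontrivial (Set.not_subsingleton_iff.1 h) hf

lemma totallyDisconnectedSpace_of_small {S : Type*} [MetricSpace S] [CompactSpace S] {δ : ℝ}
    (hδ : 0 < δ) (h : ∀ C : Set S, IsPreconnected C → (∀ x ∈ C, ∀ y ∈ C, dist x y ≤ δ) →
      C.Subsingleton) : TotallyDisconnectedSpace S := by
  suffices TotallySeparatedSpace S from inferInstance
  refine totallySeparatedSpace_iff_exists_isClopen.2 fun x y hxy => ?_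
  obtain ⟨r, hr, hrδ, hry⟩ : ∃ r > 0, r ≤ δ / 2 ∧ r ≤ dist x y :=
    ⟨min (δ / 2) (dist x y), lt_min (half_pos hδ) (dist_pos.2 hxy),
      min_le_left _ _, min_le_right _ _⟩
  have htd : IsTotallyDisconnected (Metric.closedBall x r) := fun C hC hpre =>
    h C hpre fun a ha b hb => by
      have h1 := Metric.mem_closedBall.1 (hC ha)
      have h2 := Metric.mem_closedBall.1 (hC hb)
      linarith [dist_triangle_right a b x]
  have : TotallyDisconnectedSpace (Metric.closedBall x r) :=
    totallyDisconnectedSpace_subtype_iff.2 htd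
  have : CompactSpace (Metric.closedBall x r) :=
    isCompact_iff_compactSpace.1 Metric.isClosed_closedBall.isCompact
  obtain ⟨V, hV, hxV, hVU⟩ := compact_exists_isClopen_in_isOpen
    (U := ((↑) : Metric.closedBall x r → S) ⁻¹' Metric.ball x r)
    (Metric.isOpen_ball.preimage continuous_subtype_val)
    (x := ⟨x, Metric.mem_closedBall_self hr.le⟩) (Metric.mem_ball_self hr)
  refine ⟨(↑) '' V, ⟨?_, ?_⟩, ⟨_, hxV, rfl⟩, ?_⟩
  · exact (hV.isClosed.isCompact.image continuous_subtype_val).isClosed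
  · obtain ⟨O, hO, rfl⟩ := isOpen_induced_iff.1 hV.isOpen
    have : ((↑) : Metric.closedBall x r → S) '' ((↑) ⁻¹' O) = O ∩ Metric.ball x r := by
      ext z
      constructor
      · rintro ⟨w, hw, rfl⟩
        exact ⟨hw, hVU hw⟩
      · rintro ⟨hz, hzb⟩
        exact ⟨⟨z, Metric.ball_subset_closedBall hzb⟩, hz, rfl⟩
    rw [this]
    exact hO.inter Metric.isOpen_ball
  · rintro ⟨w, hw, rfl⟩
    have := Metric.mem_ball'.1 (hVU hw)
    linarith

lemma IsCompact.isTotallyDisconnected_of_small {W : Type*} [MetricSpace W] {S : Set W}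
    (hS : IsCompact S) {δ : ℝ} (hδ : 0 < δ)
    (h : ∀ C ⊆ S, IsPreconnected C → (∀ x ∈ C, ∀ y ∈ C, dist x y ≤ δ) → C.Subsingleton) :
    IsTotallyDisconnected S := by
  have : CompactSpace S := isCompact_iff_compactSpace.1 hS
  refine totallyDisconnectedSpace_subtype_iff.1
    (totallyDisconnectedSpace_of_small hδ fun C hC hd => ?_)
  have := h ((↑) '' C) (by simp) (hC.image _ continuous_subtype_val.continuousOn) (by
    rintro _ ⟨x, hx, rfl⟩ _ ⟨y, hy, rfl⟩
    exact hd x hx y hy)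
  exact Set.subsingleton_of_image Subtype.val_injective C this

/-- The fiber product of the two maps of an s/u-bijective pair is totally disconnected. -/
lemma isTotallyDisconnected_fiber_product {X Y Z : Type*}
    [MetricSpace X] [CompactSpace X] [MetricSpace Y] [CompactSpace Y]
    [MetricSpace Z] [CompactSpace Z] {φ : X ≃ₜ X} {ψ : Y ≃ₜ Y} {ζ : Z ≃ₜ Z}
    (BX : SmaleBracket X φ) (BY : SmaleBracket Y ψ) (BZ : SmaleBracket Z ζ)
    (hYs : ∀ y : Y, IsTotallyDisconnected (stableSet ψ y))
    (hZu : ∀ z : Z, IsTotallyDisconnected (unstableSet ζ z))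
    {πs : Y → X} (hπs : Continuous πs) (hs : Function.Semiconj πs ψ φ)
    (hsinj : ∀ y : Y, InjOn πs (stableSet ψ y))
    {πu : Z → X} (hπu : Continuous πu) (hu : Function.Semiconj πu ζ φ)
    (huinj : ∀ z : Z, InjOn πu (unstableSet ζ z)) :
    IsTotallyDisconnected {p : Y × Z | πs p.1 = πu p.2} := by
  obtain ⟨η, hη, hexp⟩ := BX.expansive
  obtain ⟨δ₁, hδ₁, H₁⟩ := exists_dist_iterate_map_le hπs (Homeomorph.semiconj_symm hs) hη
  obtain ⟨δ₂, hδ₂, H₂⟩ := exists_dist_iterate_map_le hπu hu hη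
  obtain ⟨δ₃, hδ₃, H₃⟩ := BY.exists_dist_symm_iterate_le hYs
  obtain ⟨δ₄, hδ₄, H₄⟩ := BZ.symm.exists_dist_symm_iterate_le hZu
  have hclosed : IsClosed {p : Y × Z | πs p.1 = πu p.2} :=
    isClosed_eq (by fun_prop) (by fun_prop)
  obtain ⟨δ, hδ, hle₁, hle₂, hle₃, hle₄⟩ :
      ∃ δ > 0, δ ≤ δ₁ ∧ δ ≤ δ₂ ∧ δ ≤ δ₃ ∧ δ ≤ δ₄ :=
    ⟨min (min δ₁ δ₂) (min δ₃ δ₄), by positivity, by simp, by simp, by simp, by simp⟩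
  refine hclosed.isCompact.isTotallyDisconnected_of_small hδ fun C hCS hC hd => ?_
  have hdY : ∀ p ∈ C, ∀ q ∈ C, dist p.1 q.1 ≤ δ := fun p hp q hq =>
    (le_max_left _ _).trans (hd p hp q hq)
  have hdZ : ∀ p ∈ C, ∀ q ∈ C, dist p.2 q.2 ≤ δ := fun p hp q hq =>
    (le_max_right _ _).trans (hd p hp q hq)
  have hCY : IsPreconnected (Prod.fst '' C) := hC.image _ continuous_fst.continuousOn
  have hCZ : IsPreconnected (Prod.snd '' C) := hC.image _ continuous_snd.continuousOn
  have hconst : ∀ p ∈ C, ∀ q ∈ C, πs p.1 = πs q.1 := fun p hp q hq => by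
    refine hexp _ _ (fun n => ?_) (fun n => H₁ _ _ n ?_)
    · rw [hCS hp, hCS hq]
      refine H₂ _ _ n ((H₄ _ hCZ ?_ _ (mem_image_of_mem _ hp) _ (mem_image_of_mem _ hq) n).trans
        ((hdZ p hp q hq).trans hle₂))
      rintro _ ⟨a, ha, rfl⟩ _ ⟨b, hb, rfl⟩
      exact (hdZ a ha b hb).trans hle₄
    · refine (H₃ _ hCY ?_ _ (mem_image_of_mem _ hp) _ (mem_image_of_mem _ hq) n).trans
        ((hdY p hp q hq).trans hle₁)
      rintro _ ⟨a, ha, rfl⟩ _ ⟨b, hb, rfl⟩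
      exact (hdY a ha b hb).trans hle₃
  intro p hp q hq
  have hfY : (Prod.fst '' C).Finite := (finite_fiber BX BY hπs hs hsinj (πs p.1)).subset (by
    rintro _ ⟨a, ha, rfl⟩
    exact hconst a ha p hp)
  have hfZ : (Prod.snd '' C).Finite :=
    (finite_fiber BX.symm BZ.symm hπu (Homeomorph.semiconj_symm hu) huinj (πs p.1)).subset (by
      rintro _ ⟨a, ha, rfl⟩
      exact (hCS ha).symm.trans (hconst a ha p hp))
  exact Prod.ext
    (hCY.subsingleton_of_finite hfY (mem_image_of_mem _ hp) (mem_image_of_mem _ hq))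
    (hCZ.subsingleton_of_finite hfZ (mem_image_of_mem _ hp) (mem_image_of_mem _ hq))

end FiberProduct

/-- Let `(X,φ)` be a Smale space and `(Y,ψ,π_s,Z,ζ,π_u)` an s/u-bijective pair for
it.  Then the fiber product
`Σ_{L,M}(π) = {(y₀,…,y_L,z₀,…,z_M) : π_s(y_i) = π_u(z_j) ∀ i,j} ⊆ Y^{L+1} × Z^{M+1}`
is closed and invariant under `σ = ψ × ⋯ × ψ × ζ × ⋯ × ζ`, and it is a totally
disconnected compact (metrizable, as a subspace of a metric space) space. -/
theorem fiber_product_closed_invariant_compact_totallyDisconnected {X Y Z : Type*}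
    [MetricSpace X] [CompactSpace X] [MetricSpace Y] [CompactSpace Y]
    [MetricSpace Z] [CompactSpace Z]
    (φ : X ≃ₜ X) (ψ : Y ≃ₜ Y) (ζ : Z ≃ₜ Z)
    (BX : SmaleBracket X φ) (BY : SmaleBracket Y ψ) (BZ : SmaleBracket Z ζ)
    (hYs : ∀ y : Y, IsTotallyDisconnected (stableSet ψ y))
    (hZu : ∀ z : Z, IsTotallyDisconnected (unstableSet ζ z))
    (πs : Y → X) (hπs_cont : Continuous πs) (hπs_surj : Function.Surjective πs)
    (hπs_comm : ∀ y, πs (ψ y) = φ (πs y))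
    (hπs_sbij : ∀ y : Y, Set.BijOn πs (stableSet ψ y) (stableSet φ (πs y)))
    (πu : Z → X) (hπu_cont : Continuous πu) (hπu_surj : Function.Surjective πu)
    (hπu_comm : ∀ z, πu (ζ z) = φ (πu z))
    (hπu_ubij : ∀ z : Z, Set.BijOn πu (unstableSet ζ z) (unstableSet φ (πu z)))
    (L M : ℕ) :
    IsClosed {p : (Fin (L + 1) → Y) × (Fin (M + 1) → Z) |
        ∀ a b, πs (p.1 a) = πu (p.2 b)} ∧
    (fun p : (Fin (L + 1) → Y) × (Fin (M + 1) → Z) =>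
        ((fun a => ψ (p.1 a), fun b => ζ (p.2 b)) :
          (Fin (L + 1) → Y) × (Fin (M + 1) → Z))) ''
        {p | ∀ a b, πs (p.1 a) = πu (p.2 b)} =
      {p : (Fin (L + 1) → Y) × (Fin (M + 1) → Z) | ∀ a b, πs (p.1 a) = πu (p.2 b)} ∧
    IsCompact {p : (Fin (L + 1) → Y) × (Fin (M + 1) → Z) |
        ∀ a b, πs (p.1 a) = πu (p.2 b)} ∧
    IsTotallyDisconnected {p : (Fin (L + 1) → Y) × (Fin (M + 1) → Z) |
        ∀ a b, πs (p.1 a) = πu (p.2 b)} := by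
  have hs : Function.Semiconj πs ψ φ := hπs_comm
  have hu : Function.Semiconj πu ζ φ := hπu_comm
  have hclosed : IsClosed {p : (Fin (L + 1) → Y) × (Fin (M + 1) → Z) |
      ∀ a b, πs (p.1 a) = πu (p.2 b)} := by
    simp only [Set.ofPred_forall]
    exact isClosed_iInter fun a => isClosed_iInter fun b =>
      isClosed_eq (by fun_prop) (by fun_prop)
  refine ⟨hclosed, ?_, hclosed.isCompact, ?_⟩
  · ext p
    constructor
    · rintro ⟨q, hq, rfl⟩ a b
      simp only [hπs_comm, hπu_comm, hq a b]
    · intro hp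
      refine ⟨(fun a => ψ.symm (p.1 a), fun b => ζ.symm (p.2 b)), fun a b => ?_, by simp⟩
      simp only [(Homeomorph.semiconj_symm hs).eq, (Homeomorph.semiconj_symm hu).eq, hp a b]
  · intro C hCS hC p hp q hq
    have key : ∀ a b, (p.1 a, p.2 b) = (q.1 a, q.2 b) := fun a b => by
      refine isTotallyDisconnected_fiber_product BX BY BZ hYs hZu hπs_cont hs
        (fun y => (hπs_sbij y).injOn) hπu_cont hu (fun z => (hπu_ubij z).injOn)
        ((fun p : (Fin (L + 1) → Y) × (Fin (M + 1) → Z) => (p.1 a, p.2 b)) '' C) ?_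
        (hC.image _ (by fun_prop)) (Set.mem_image_of_mem _ hp) (Set.mem_image_of_mem _ hq)
      rintro _ ⟨r, hr, rfl⟩
      exact hCS hr a b
    exact Prod.ext (funext fun a => congrArg Prod.fst (key a 0))
      (funext fun b => congrArg Prod.snd (key 0 b))
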